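/- arXiv:2005.11428 — 7 statements merged into one kernel-verified Lean document; each statement's English description precedes it below -/
import Mathlib

section
/- For every n ≥ 1 and every choice of signs c₁, …, cₙ ∈ {−1, +1} there exists ε₀ > 0 such that for all ε with 0 < ε < ε₀ the 2×2 real matrix P(ε) := (J₀·U(−cₙ/ε))·(J₀·U(−c_{n−1}/ε))⋯(J₀·U(−c₁/ε)) satisfies |tr P(ε)| > 2 (so P(ε) ∈ SL(2,ℝ) is a hyperbolic element). More precisely, εⁿ·tr P(ε) → ∏_{i=1}^{n}(−c_i) = ±1 as ε → 0⁺. -/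
/- Matrices arising as linearized Poincaré return maps of closed Reeb orbits of the
surgered contact forms `α_ε`: passing through a surgery handle with coefficient
`c ∈ {±1}` contributes a factor `J₀ · U (-c/ε)`. -/

noncomputable section

open Matrix Filter

/-- `J₀ = [[0,-1],[1,0]]`. -/
def J0 : Matrix (Fin 2) (Fin 2) ℝ := !![0, -1; 1, 0]

/-- `U b = [[1,b],[0,1]]`. -/
def U (b : ℝ) : Matrix (Fin 2) (Fin 2) ℝ := !![1, b; 0, 1]

lemma aux_prod (ε : ℝ) (hε : ε ≠ 0) (l : List ℝ) :
    ε ^ l.length • (l.map fun c => J0 * U (-c / ε)).prod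
      = (l.map fun c => (!![0, -ε; ε, -c] : Matrix (Fin 2) (Fin 2) ℝ)).prod := by
  induction l with
  | nil => simp
  | cons a l ih =>
    have h : ε • (J0 * U (-a / ε)) = (!![0, -ε; ε, -a] : Matrix (Fin 2) (Fin 2) ℝ) := by
      ext i j
      fin_cases i <;> fin_cases j <;> simp [J0, U]
      field_simp
    rw [List.map_cons, List.prod_cons, List.map_cons, List.prod_cons, ← ih, ← h,
      List.length_cons, pow_succ', smul_mul_smul_comm]

lemma aux_zero (l : List ℝ) :
    (l.map fun c => (!![0, -0; 0, -c] : Matrix (Fin 2) (Fin 2) ℝ)).prod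
      = !![0 ^ l.length, 0; 0, (l.map fun c => -c).prod] := by
  induction l with
  | nil => simp [Matrix.one_fin_two]
  | cons a l ih =>
    rw [List.map_cons, List.prod_cons, ih]
    ext i j
    fin_cases i <;> fin_cases j <;> simp

lemma aux_cont (l : List ℝ) : Continuous fun ε : ℝ =>
    (l.map fun c => (!![0, -ε; ε, -c] : Matrix (Fin 2) (Fin 2) ℝ)).prod := by
  apply continuous_list_prod
  intro c _
  refine continuous_matrix fun i j => ?_
  fin_cases i <;> fin_cases j <;> simp <;> fun_prop

lemma aux_tendsto (n : ℕ) (hn : 1 ≤ n) (c : Fin n → ℝ) :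
    Tendsto
      (fun ε : ℝ =>
        ε ^ n * ((List.ofFn fun i : Fin n => J0 * U (-(c i) / ε)).reverse.prod).trace)
      (nhdsWithin 0 (Set.Ioi 0)) (nhds (∏ i, -c i)) := by
  set l := (List.ofFn c).reverse with hl
  have hlen : l.length = n := by simp [hl]
  have h1 := ((aux_cont l).matrix_trace.tendsto 0).mono_left
    (nhdsWithin_le_nhds (s := Set.Ioi (0 : ℝ)))
  rw [aux_zero, hlen] at h1
  have h2 : (l.map fun c => -c).prod = ∏ i, -c i := by
    rw [hl, List.map_reverse, List.prod_reverse, List.map_ofFn, List.prod_ofFn]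
    rfl
  rw [h2, Matrix.trace_fin_two_of, zero_pow (by omega), zero_add] at h1
  refine h1.congr' ?_
  filter_upwards [self_mem_nhdsWithin] with ε hε
  rw [← aux_prod ε (ne_of_gt hε) l, hlen, Matrix.trace_smul, smul_eq_mul, hl, List.map_reverse,
    List.map_ofFn]
  rfl

/-- For every `n ≥ 1` and signs `c₁, …, cₙ ∈ {−1,+1}` there is `ε₀ > 0` such
that for `0 < ε < ε₀` the product
`P(ε) = (J₀·U(−cₙ/ε))·(J₀·U(−c_{n−1}/ε))⋯(J₀·U(−c₁/ε))`
has `|tr P(ε)| > 2` (it is a hyperbolic element of SL(2,ℝ)); more precisely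
`εⁿ · tr P(ε) → ∏ᵢ (−cᵢ) = ±1` as `ε → 0⁺`. -/
theorem trace_of_return_map_hyperbolic (n : ℕ) (hn : 1 ≤ n) (c : Fin n → ℝ)
    (hc : ∀ i, c i = 1 ∨ c i = -1) :
    (∃ ε₀ > (0 : ℝ), ∀ ε : ℝ, 0 < ε → ε < ε₀ →
      2 < |((List.ofFn fun i : Fin n => J0 * U (-(c i) / ε)).reverse.prod).trace|) ∧
    Tendsto
      (fun ε : ℝ =>
        ε ^ n * ((List.ofFn fun i : Fin n => J0 * U (-(c i) / ε)).reverse.prod).trace)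
      (nhdsWithin 0 (Set.Ioi 0)) (nhds (∏ i, -c i)) ∧
    ((∏ i, -c i) = 1 ∨ (∏ i, -c i) = -1) := by
  have hP : (∏ i, -c i) = 1 ∨ (∏ i, -c i) = -1 := by
    refine Finset.prod_induction (fun i => -c i) (fun x => x = 1 ∨ x = -1) ?_ (Or.inl rfl) ?_
    · rintro a b (rfl | rfl) (rfl | rfl) <;> simp
    · intro i _
      rcases hc i with h | h <;> simp [h]
  have hT := aux_tendsto n hn c
  refine ⟨?_, hT, hP⟩
  have habs : |∏ i, -c i| = 1 := by rcases hP with h | h <;> simp [h]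
  have h1 := hT.abs
  rw [habs] at h1
  have h2 := h1.eventually (lt_mem_nhds (show (1 / 2 : ℝ) < 1 by norm_num))
  obtain ⟨u, hu, h3⟩ := mem_nhdsGT_iff_exists_Ioo_subset.1 h2
  refine ⟨min u (1 / 4), lt_min hu (by norm_num), fun ε hε hlt => ?_⟩
  have h4 := h3 ⟨hε, hlt.trans_le (min_le_left _ _)⟩
  have h5 : ε < 1 / 4 := hlt.trans_le (min_le_right _ _)
  simp only [Set.mem_ofPred_eq] at h4
  rw [abs_mul, abs_of_pos (pow_pos hε n)] at h4
  have h6 : ε ^ n ≤ ε := pow_le_of_le_one hε.le (by linarith) (by omega)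
  by_contra hcon
  have h7 := mul_le_mul (h6.trans h5.le) (not_lt.1 hcon) (abs_nonneg _) (by norm_num)
  linarith

end
end

section
/- For every n ≥ 1 and all real numbers b₁, …, bₙ one has the 2×2 real matrix identity (J₀·U(bₙ))·(J₀·U(b_{n−1}))⋯(J₀·U(b₁)) = J₀ⁿ + Σ_{K=1}^{n} Σ_{k ∈ I_K} (∏_{i=1}^{K} b_{k_i}) · M_k, where the inner sum runs over all strictly increasing K-tuples k = (k₁ < ⋯ < k_K) of indices in {1, …, n}. -/
noncomputable section

open Matrix

/-- `D = [[0,0],[0,1]]`. -/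
def D : Matrix (Fin 2) (Fin 2) ℝ := !![0, 0; 0, 1]

/-- Given a "top" exponent `t` and a strictly decreasing list `[a_K, …, a₁]` of
0-indexed positions, `MkAux t [a_K, …, a₁] = J₀^(t−1−a_K) · D · J₀^(a_K−1−a_{K-1}) · D ⋯
D · J₀^(a₁)`. -/
def MkAux : ℕ → List ℕ → Matrix (Fin 2) (Fin 2) ℝ
  | t, [] => J0 ^ t
  | t, a :: rest => J0 ^ (t - 1 - a) * D * MkAux a rest

/-- For a subset `s ⊆ {0, …, n−1}` corresponding to the strictly increasing tuple
`k = (k₁ < ⋯ < k_K)` in `{1, …, n}` (via `kᵢ = aᵢ + 1`), this is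
`M_k = J₀^(n−k_K) · D · J₀^(k_K−k_{K−1}−1) · D ⋯ D · J₀^(k₁−1)`. -/
def Mk (n : ℕ) (s : Finset (Fin n)) : Matrix (Fin 2) (Fin 2) ℝ :=
  MkAux n (((s.sort (· ≤ ·)).map Fin.val).reverse)

lemma J0_mul_U (b : ℝ) : J0 * U b = J0 + b • D := by
  ext i j
  fin_cases i <;> fin_cases j <;> simp [J0, U, D, Matrix.mul_apply, Fin.sum_univ_two]

lemma MkAux_succ (t : ℕ) (l : List ℕ) (hl : ∀ a ∈ l, a < t) :
    MkAux (t + 1) l = J0 * MkAux t l := by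
  cases l with
  | nil => simp [MkAux, pow_succ']
  | cons a r =>
    have ha : a < t := hl a (by simp)
    have h : t + 1 - 1 - a = (t - 1 - a) + 1 := by omega
    simp only [MkAux]
    rw [h, pow_succ']
    simp only [Matrix.mul_assoc]

lemma sort_insert_last (t : ℕ) (s : Finset ℕ) (hs : ∀ a ∈ s, a < t) :
    (insert t s).sort (· ≤ ·) = s.sort (· ≤ ·) ++ [t] := by
  have hn : (s.sort (· ≤ ·) ++ [t]).Nodup := by
    rw [List.nodup_append]
    refine ⟨Finset.sort_nodup _ _, by simp, ?_⟩
    intro a ha b hb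
    have := hs a (by simpa using ha)
    simp at hb
    omega
  have hf : (s.sort (· ≤ ·) ++ [t]).toFinset = insert t s := by
    ext a; simp
  rw [← hf, List.toFinset_sort _ hn, List.pairwise_append]
  refine ⟨Finset.pairwise_sort _ _, by simp, ?_⟩
  intro a ha b hb
  have := hs a (by simpa using ha)
  simp at hb
  omega

lemma expansion_nat (c : ℕ → ℝ) (n : ℕ) :
    (List.ofFn fun i : Fin n => J0 * U (c i)).reverse.prod
      = ∑ s ∈ (Finset.range n).powerset, (∏ i ∈ s, c i) • MkAux n (s.sort (· ≤ ·)).reverse := by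
  induction n with
  | zero => simp [MkAux]
  | succ n ih =>
    rw [List.ofFn_succ', Finset.range_add_one, Finset.sum_powerset_insert (by simp)]
    simp only [List.concat_eq_append, List.reverse_append, List.reverse_singleton,
      List.prod_append, List.prod_singleton, Fin.val_castSucc, Fin.val_last]
    rw [ih, J0_mul_U, Matrix.add_mul, Finset.mul_sum, Finset.mul_sum]
    congr 1
    · refine Finset.sum_congr rfl fun s hs => ?_
      rw [MkAux_succ, Matrix.mul_smul]
      intro a ha
      have := Finset.mem_powerset.1 hs (show a ∈ s by simpa using ha)
      simpa using this
    · refine Finset.sum_congr rfl fun s hs => ?_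
      have h : ∀ a ∈ s, a < n := fun a ha => by
        simpa using Finset.mem_powerset.1 hs ha
      rw [sort_insert_last n s h, Finset.prod_insert (fun hh => lt_irrefl _ (h n hh))]
      simp [MkAux, smul_smul, mul_comm]

lemma expansion_fin (n : ℕ) (b : Fin n → ℝ) :
    (List.ofFn fun i : Fin n => J0 * U (b i)).reverse.prod
      = ∑ s ∈ (Finset.univ : Finset (Fin n)).powerset, (∏ i ∈ s, b i) • Mk n s := by
  have h := expansion_nat (fun i => if h : i < n then b ⟨i, h⟩ else 0) n
  simp only [Fin.is_lt, dite_true, Fin.eta] at h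
  rw [h]
  symm
  refine Finset.sum_bij (fun s _ => s.map Fin.valEmbedding) ?_ ?_ ?_ ?_
  · intro s _
    rw [Finset.mem_powerset]
    intro a ha
    simp only [Finset.mem_map, Fin.valEmbedding_apply] at ha
    obtain ⟨x, _, rfl⟩ := ha
    simp
  · intro s _ t _ hst
    exact Finset.map_injective _ hst
  · intro t ht
    have h : ∀ a ∈ t, a < n := fun a ha => by
      simpa using Finset.mem_powerset.1 ht ha
    exact ⟨t.attachFin h, by simp, by simp⟩
  · intro s _
    have hs : (s.sort (· ≤ ·)).map Fin.val = (s.map Fin.valEmbedding).sort (· ≤ ·) :=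
      Finset.map_sort Fin.valEmbedding s _ _ (fun a _ b _ => Iff.rfl)
    rw [Mk, hs, Finset.prod_map]
    simp

/-- for all `n ≥ 1` and reals `b₁, …, bₙ`,
`(J₀·U(bₙ))·(J₀·U(b_{n−1}))⋯(J₀·U(b₁)) = J₀ⁿ + Σ_{K=1}^{n} Σ_{k ∈ I_K} (∏ᵢ b_{kᵢ}) · M_k`,
the inner sum over all strictly increasing `K`-tuples of indices in `{1, …, n}`
(equivalently, all `K`-element subsets). -/
theorem return_map_expansion (n : ℕ) (hn : 1 ≤ n) (b : Fin n → ℝ) :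
    (List.ofFn fun i : Fin n => J0 * U (b i)).reverse.prod
      = J0 ^ n + ∑ K ∈ Finset.Icc 1 n,
          ∑ s ∈ Finset.powersetCard K (Finset.univ : Finset (Fin n)),
            (∏ i ∈ s, b i) • Mk n s := by
  rw [expansion_fin, Finset.sum_powerset, Finset.card_univ, Fintype.card_fin,
    Finset.sum_range_succ', add_comm]
  congr 1
  · simp [Mk, MkAux]
  · rw [Finset.range_eq_Ico, Finset.sum_Ico_add' (fun K =>
      ∑ s ∈ Finset.powersetCard K (Finset.univ : Finset (Fin n)), (∏ i ∈ s, b i) • Mk n s) 0 n 1]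
    rfl

end
end

section
/- Let f : ℝ → ℝ be continuously differentiable with f′ compactly supported, let H(p) := ∫_{−∞}^{p} P·f′(P) dP, and fix c ∈ {−1, +1}. Define φ : ℝ³ → ℝ³ by φ(z,p,q) = (z − c·H(p), p, q + c·f(p)). Then φ preserves the 1-form dz + p dq: for every (z,p,q) ∈ ℝ³ and every v = (v_z, v_p, v_q) ∈ ℝ³, writing w = Dφ_{(z,p,q)}(v) for the image of v under the total derivative of φ (whose components we label (w_z, w_p, w_q)), one has w_z + p·w_q = v_z + p·v_q. (Note the middle coordinate of φ(z,p,q) equals p, so this is the pullback identity φ*(dz + p dq) = dz + p dq.) -/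
noncomputable section

open MeasureTheory

/-- let `f : ℝ → ℝ` be C¹ with compactly supported derivative, let
`H(p) = ∫_{−∞}^p P·f′(P) dP`, and let `c = ±1`.  The contact surgery gluing map
`φ(z,p,q) = (z − c·H(p), p, q + c·f(p))` preserves the 1-form `dz + p dq`: for every
point `x = (z,p,q)` and every tangent vector `v = (v_z, v_p, v_q)`, the image
`w = Dφ_x(v)` satisfies `w_z + p·w_q = v_z + p·v_q`. -/
theorem gluing_map_preserves_contact_form
    (f : ℝ → ℝ) (hf : ContDiff ℝ 1 f) (hsupp : HasCompactSupport (deriv f))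
    (c : ℝ) (hc : c = 1 ∨ c = -1) :
    ∀ x v : ℝ × ℝ × ℝ,
      (fderiv ℝ
          (fun x : ℝ × ℝ × ℝ =>
            ((x.1 - c * ∫ P in Set.Iic x.2.1, P * deriv f P, x.2.1,
              x.2.2 + c * f x.2.1) : ℝ × ℝ × ℝ))
          x v).1
        + x.2.1 *
          (fderiv ℝ
            (fun x : ℝ × ℝ × ℝ =>
              ((x.1 - c * ∫ P in Set.Iic x.2.1, P * deriv f P, x.2.1,
                x.2.2 + c * f x.2.1) : ℝ × ℝ × ℝ))
            x v).2.2
        = v.1 + x.2.1 * v.2.2 := by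
  intro x v
  have hcont : Continuous (fun P : ℝ => P * deriv f P) :=
    continuous_id.mul (hf.continuous_deriv le_rfl)
  have hint : Integrable (fun P : ℝ => P * deriv f P) :=
    hcont.integrable_of_hasCompactSupport hsupp.mul_left
  have hH : ∀ p : ℝ, HasDerivAt (fun p : ℝ => ∫ P in Set.Iic p, P * deriv f P)
      (p * deriv f p) p := by
    intro p
    have h1 : HasDerivAt (fun u : ℝ => (∫ P in (0:ℝ)..u, P * deriv f P)
        + ∫ P in Set.Iic (0:ℝ), P * deriv f P) (p * deriv f p) p :=
      (intervalIntegral.integral_hasDerivAt_right (hcont.intervalIntegrable _ _)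
        hcont.stronglyMeasurable.stronglyMeasurableAtFilter hcont.continuousAt).add_const _
    refine h1.congr_of_eventuallyEq (Filter.Eventually.of_forall fun u => ?_)
    have := intervalIntegral.integral_Iic_sub_Iic (a := (0:ℝ)) (b := u)
      hint.integrableOn hint.integrableOn
    simp only
    linarith
  have hfd : HasDerivAt f (deriv f x.2.1) x.2.1 :=
    (hf.differentiable one_ne_zero x.2.1).hasDerivAt
  have hp : HasFDerivAt (fun x : ℝ × ℝ × ℝ => x.2.1)
      ((ContinuousLinearMap.fst ℝ ℝ ℝ).comp (ContinuousLinearMap.snd ℝ ℝ (ℝ × ℝ))) x :=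
    ((ContinuousLinearMap.fst ℝ ℝ ℝ).comp (ContinuousLinearMap.snd ℝ ℝ (ℝ × ℝ))).hasFDerivAt
  have hq : HasFDerivAt (fun x : ℝ × ℝ × ℝ => x.2.2)
      ((ContinuousLinearMap.snd ℝ ℝ ℝ).comp (ContinuousLinearMap.snd ℝ ℝ (ℝ × ℝ))) x :=
    ((ContinuousLinearMap.snd ℝ ℝ ℝ).comp (ContinuousLinearMap.snd ℝ ℝ (ℝ × ℝ))).hasFDerivAt
  have hz : HasFDerivAt (fun x : ℝ × ℝ × ℝ => x.1)
      (ContinuousLinearMap.fst ℝ ℝ (ℝ × ℝ)) x := hasFDerivAt_fst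
  have hA := hz.fun_sub (((hH x.2.1).comp_hasFDerivAt x hp).const_mul c)
  have hB := hq.fun_add ((hfd.comp_hasFDerivAt x hp).const_mul c)
  have hF := hA.prodMk (hp.prodMk hB)
  have hE := hF.fderiv
  simp only [Function.comp_def] at hE
  rw [hE]
  simp
  ring

end
end

section
/- Let F, G : ℝ → ℝ be smooth with c(z,p) := 1 + F(z)G(p) − p·F(z)G′(p) > 0 everywhere, and let R_h(z,p,q) := c(z,p)^{−1}·(1, 0, −F(z)G′(p)) on ℝ³ (coordinates (z,p,q)). If γ : I → ℝ³ is an integral curve of R_h (i.e. γ′(s) = R_h(γ(s)) for all s in an interval I containing 0) with γ(0) = (z₀, p₀, q₀), then: the p-coordinate of γ is constantly p₀; the z-coordinate of γ is strictly increasing; and for every s ∈ I the q-coordinate satisfies q(γ(s)) = q₀ − G′(p₀) · ∫_{z₀}^{z(γ(s))} F(Z) dZ. -/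
noncomputable section

/-- The contact coefficient `c(z,p) = 1 + F(z)G(p) − p·F(z)·G′(p)` for the contact form
`α_h = (1 + F(z)G(p)) dz + p dq`. -/
def contactCoeff (F G : ℝ → ℝ) (z p : ℝ) : ℝ := 1 + F z * G p - p * F z * deriv G p

/-- The vector field `R_h = c(z,p)⁻¹ (∂_z − F(z)G′(p) ∂_q)`, components in the order
`(z,p,q)`. -/
def Rh (F G : ℝ → ℝ) (z p : ℝ) : ℝ × ℝ × ℝ :=
  ((contactCoeff F G z p)⁻¹ * 1, (contactCoeff F G z p)⁻¹ * 0,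
   (contactCoeff F G z p)⁻¹ * (-(F z * deriv G p)))

theorem const_of_hasDerivAt_zero_aux (I : Set ℝ) (hI : I.OrdConnected) (f : ℝ → ℝ)
    (hf : ∀ s ∈ I, HasDerivAt f 0 s) (a b : ℝ) (ha : a ∈ I) (hb : b ∈ I) : f b = f a := by
  have h := Convex.norm_image_sub_le_of_norm_hasDerivWithin_le (C := 0) (f' := fun _ => 0)
    (fun s hs => (hf s hs).hasDerivWithinAt) (by simp) hI.convex ha hb
  rw [zero_mul] at h
  exact sub_eq_zero.mp (norm_le_zero_iff.mp h)

/-- let `F, G` be smooth with `c(z,p) > 0` everywhere, and let `γ` be an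
integral curve of `R_h` defined on an interval `I ∋ 0` with `γ(0) = (z₀,p₀,q₀)`.  Then
the `p`-coordinate of `γ` is constantly `p₀`, the `z`-coordinate is strictly increasing,
and the `q`-coordinate satisfies `q(γ(s)) = q₀ − G′(p₀)·∫_{z₀}^{z(γ(s))} F(Z) dZ`. -/
theorem flow_of_twist_reeb_field
    (F G : ℝ → ℝ) (hF : ContDiff ℝ (⊤ : ℕ∞) F) (hG : ContDiff ℝ (⊤ : ℕ∞) G)
    (hc : ∀ z p : ℝ, 0 < contactCoeff F G z p)
    (I : Set ℝ) (hI : I.OrdConnected) (h0 : (0 : ℝ) ∈ I)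
    (γ : ℝ → ℝ × ℝ × ℝ)
    (hγ : ∀ s ∈ I, HasDerivAt γ (Rh F G (γ s).1 (γ s).2.1) s)
    (z₀ p₀ q₀ : ℝ) (hinit : γ 0 = (z₀, p₀, q₀)) :
    (∀ s ∈ I, (γ s).2.1 = p₀) ∧
    StrictMonoOn (fun s => (γ s).1) I ∧
    (∀ s ∈ I, (γ s).2.2 = q₀ - deriv G p₀ * ∫ Z in z₀..(γ s).1, F Z) := by
  have hz : ∀ s ∈ I, HasDerivAt (fun s => (γ s).1)
      ((contactCoeff F G (γ s).1 (γ s).2.1)⁻¹ * 1) s := fun s hs =>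
    (hasFDerivAt_fst (𝕜 := ℝ) (p := γ s)).comp_hasDerivAt s (hγ s hs)
  have h2 : ∀ s ∈ I, HasDerivAt (fun s => (γ s).2)
      (Rh F G (γ s).1 (γ s).2.1).2 s := fun s hs =>
    (hasFDerivAt_snd (𝕜 := ℝ) (p := γ s)).comp_hasDerivAt s (hγ s hs)
  have hp : ∀ s ∈ I, HasDerivAt (fun s => (γ s).2.1)
      ((contactCoeff F G (γ s).1 (γ s).2.1)⁻¹ * 0) s := fun s hs =>
    by
    have h := HasFDerivAt.comp_hasDerivAt (f := fun s => (γ s).2) s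
      (hasFDerivAt_fst (𝕜 := ℝ) (E := ℝ) (F := ℝ) (p := (γ s).2)) (h2 s hs)
    exact h
  have hq : ∀ s ∈ I, HasDerivAt (fun s => (γ s).2.2)
      ((contactCoeff F G (γ s).1 (γ s).2.1)⁻¹ * (-(F (γ s).1 * deriv G (γ s).2.1))) s :=
    fun s hs => by
    have h := HasFDerivAt.comp_hasDerivAt (f := fun s => (γ s).2) s
      (hasFDerivAt_snd (𝕜 := ℝ) (E := ℝ) (F := ℝ) (p := (γ s).2)) (h2 s hs)
    exact h
  have hpc : ∀ s ∈ I, (γ s).2.1 = p₀ := by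
    intro s hs
    have h := const_of_hasDerivAt_zero_aux I hI (fun s => (γ s).2.1)
      (fun s hs => by simpa using hp s hs) 0 s h0 hs
    simpa [hinit] using h
  refine ⟨hpc, ?_, ?_⟩
  · refine strictMonoOn_of_deriv_pos hI.convex
      (fun s hs => (hz s hs).continuousAt.continuousWithinAt) ?_
    intro s hs
    rw [(hz s (interior_subset hs)).deriv, mul_one]
    exact inv_pos.mpr (hc _ _)
  · intro s hs
    have hint : ∀ x, HasDerivAt (fun u => ∫ Z in z₀..u, F Z) (F x) x := fun x =>
      intervalIntegral.integral_hasDerivAt_right (hF.continuous.intervalIntegrable _ _)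
        (hF.continuous.stronglyMeasurableAtFilter _ _) hF.continuous.continuousAt
    have h := const_of_hasDerivAt_zero_aux I hI
      (fun s => (γ s).2.2 + deriv G p₀ * ∫ Z in z₀..(γ s).1, F Z)
      (fun s hs => by
        have h1 := (hq s hs).add
          (((hint (γ s).1).comp s (hz s hs)).const_mul (deriv G p₀))
        rw [hpc s hs] at h1
        refine h1.congr_deriv ?_
        ring) 0 s h0 hs
    simp only [hinit, intervalIntegral.integral_same, mul_zero, add_zero] at h
    linarith

end
end

section
/- Consider ℝ⁴ = ℝ_t × ℝ_z × ℝ²_{(x,y)}, regarded as the symplectization of the contactization (ℝ³, α = dz − y dx) of (ℝ², β = −y dx), and define the almost complex structure J′ which at a point whose ℝ²-coordinate is (x,y) acts by J′(a, b, v₁, v₂) = (−b + y·v₁, a − y·v₂, −v₂, v₁). Let Ω ⊆ ℂ be open and let Φ = (t, z, u) : Ω → ℝ × ℝ × ℝ² be twice continuously differentiable, where u is viewed as ℂ-valued. If Φ is J′-holomorphic, i.e. DΦ_w(i·ζ) = J′(Φ(w))(DΦ_w(ζ)) for all w ∈ Ω and ζ ∈ ℂ, then z is harmonic on Ω (its Laplacian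 vanishes) and u : Ω → ℂ is holomorphic. Conversely, if Ω is simply connected, z : Ω → ℝ is harmonic, and u : Ω → ℂ is holomorphic, then there exists t : Ω → ℝ such that Φ = (t, z, u) is J′-holomorphic, and any two such functions t differ by an additive constant. -/
noncomputable section

/-- The Laplacian of a function `z : ℂ → ℝ`, computed as the sum of the second
derivatives in the directions `1` and `I`. -/
def lap (z : ℂ → ℝ) (w : ℂ) : ℝ :=
  fderiv ℝ (fun w' => fderiv ℝ z w' 1) w 1
    + fderiv ℝ (fun w' => fderiv ℝ z w' Complex.I) w Complex.I

/-- `Φ = (t, z, u) : Ω → ℝ × ℝ × ℝ²` is `J′`-holomorphic, where `J′` acts at a point with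
`ℝ² = ℂ` coordinate `u` by `J′(a, b, v₁, v₂) = (−b + y·v₁, a − y·v₂, −v₂, v₁)` with
`y = im u`: at every `w ∈ Ω` the derivative `DΦ_w` exists and satisfies
`DΦ_w(i·ζ) = J′(Φ(w))(DΦ_w(ζ))` for all `ζ ∈ ℂ`. -/
def JHolomorphic (t z : ℂ → ℝ) (u : ℂ → ℂ) (Ω : Set ℂ) : Prop :=
  ∀ w ∈ Ω,
    DifferentiableAt ℝ t w ∧ DifferentiableAt ℝ z w ∧ DifferentiableAt ℝ u w ∧
    ∀ ζ : ℂ,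
      fderiv ℝ t w (Complex.I * ζ)
          = -(fderiv ℝ z w ζ) + (u w).im * (fderiv ℝ u w ζ).re ∧
      fderiv ℝ z w (Complex.I * ζ)
          = fderiv ℝ t w ζ - (u w).im * (fderiv ℝ u w ζ).im ∧
      fderiv ℝ u w (Complex.I * ζ) = Complex.I * fderiv ℝ u w ζ

/-- A discrete copy of the complex numbers. -/
structure DiscC where
  val : ℂ

instance : TopologicalSpace DiscC := ⊥

instance : DiscreteTopology DiscC := ⟨rfl⟩

open Topology in
lemma exists_primitive_of_simplyConnected {Ω : Set ℂ} (hΩ : IsOpen Ω)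
    (hs : SimplyConnectedSpace Ω) {g : ℂ → ℂ} (hg : DifferentiableOn ℂ g Ω) :
    ∃ G : ℂ → ℂ, ∀ w ∈ Ω, HasDerivAt G (g w) w := by
  classical
  have key : ∀ x : Ω, ∃ r > 0, Metric.ball (x : ℂ) r ⊆ Ω ∧
      ∃ F : ℂ → ℂ, ∀ w ∈ Metric.ball (x : ℂ) r, HasDerivAt F (g w) w := by
    intro x
    obtain ⟨r, hr, hb⟩ := Metric.isOpen_iff.1 hΩ x x.2
    exact ⟨r, hr, hb, (hg.mono hb).isExactOn_ball⟩
  choose r hr hb F hF using key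
  have hconst : ∀ i j : Ω, ∀ y ∈ Metric.ball (i : ℂ) (r i) ∩ Metric.ball (j : ℂ) (r j),
      ∀ y' ∈ Metric.ball (i : ℂ) (r i) ∩ Metric.ball (j : ℂ) (r j),
      F i y - F j y = F i y' - F j y' := by
    intro i j y hy y' hy'
    have hd : ∀ w ∈ Metric.ball (i : ℂ) (r i) ∩ Metric.ball (j : ℂ) (r j),
        HasDerivAt (fun w => F i w - F j w) 0 w := by
      intro w hw
      have h := (hF i w hw.1).fun_sub (hF j w hw.2)
      rwa [sub_self] at h
    have ho : IsOpen (Metric.ball (i : ℂ) (r i) ∩ Metric.ball (j : ℂ) (r j)) :=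
      Metric.isOpen_ball.inter Metric.isOpen_ball
    have hc : Convex ℝ (Metric.ball (i : ℂ) (r i) ∩ Metric.ball (j : ℂ) (r j)) :=
      (convex_ball _ _).inter (convex_ball _ _)
    exact ho.is_const_of_deriv_eq_zero (f := fun w => F i w - F j w)
      hc.isPreconnected
      (fun w hw => (hd w hw).differentiableAt.differentiableWithinAt)
      (fun w hw => (hd w hw).deriv) hy hy'
  let Z : FiberBundleCore Ω Ω DiscC :=
    { baseSet := fun i => Subtype.val ⁻¹' (Metric.ball (i : ℂ) (r i))
      isOpen_baseSet := fun i => Metric.isOpen_ball.preimage continuous_subtype_val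
      indexAt := fun x => x
      mem_baseSet_at := fun x => by simpa using hr x
      coordChange := fun i j x v => ⟨v.val + (F i x - F j x)⟩
      coordChange_self := by
        intro i x hx v
        simp
      continuousOn_coordChange := by
        intro i j
        rintro ⟨y, c⟩ ⟨hy, -⟩
        apply ContinuousAt.continuousWithinAt
        apply (continuousAt_const (y := (⟨c.val + (F i y - F j y)⟩ : DiscC))).congr
        have h1 : ∀ᶠ p : Ω × DiscC in 𝓝 (y, c), (p.1 : ℂ) ∈
            Metric.ball (i : ℂ) (r i) ∩ Metric.ball (j : ℂ) (r j) := by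
          have ho : IsOpen (Metric.ball (i : ℂ) (r i) ∩ Metric.ball (j : ℂ) (r j)) :=
            Metric.isOpen_ball.inter Metric.isOpen_ball
          exact (continuous_subtype_val.comp continuous_fst).continuousAt.eventually_mem
            (ho.mem_nhds hy)
        have h2 : ∀ᶠ p : Ω × DiscC in 𝓝 (y, c), p.2 ∈ ({c} : Set DiscC) :=
          continuous_snd.continuousAt.eventually_mem ((isOpen_discrete {c}).mem_nhds rfl)
        filter_upwards [h1, h2] with p hp1 hp2
        have hp2' : p.2 = c := hp2
        rw [hp2', hconst i j y hy p.1 hp1]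
      coordChange_comp := by
        intro i j k x hx v
        simp only [DiscC.mk.injEq]
        ring }
  have hcov : IsCoveringMap (Bundle.TotalSpace.proj : Bundle.TotalSpace DiscC Z.Fiber → Ω) :=
    FiberBundle.isCoveringMap
  have := hΩ.locallyPathConnectedSpace
  let x₀ : Ω := Classical.choice (inferInstance : Nonempty Ω)
  obtain ⟨f, ⟨-, hf⟩, -⟩ := hcov.existsUnique_continuousMap_lifts (ContinuousMap.id Ω) x₀
    (⟨x₀, (⟨0⟩ : DiscC)⟩ : Bundle.TotalSpace DiscC Z.Fiber) rfl
  have hf' : ∀ x, (f x).proj = x := fun x => congrFun hf x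
  let v : Ω → DiscC := fun x => (f x).2
  refine ⟨fun w => if h : w ∈ Ω then (v ⟨w, h⟩).val + F ⟨w, h⟩ w else 0, fun w hw => ?_⟩
  set i : Ω := ⟨w, hw⟩ with hi
  have hcont : ContinuousAt (fun x : Ω => (Z.localTriv i (f x)).2) i := by
    have h1 : ContinuousAt (Z.localTriv i) (f i) := by
      apply (Z.localTriv i).continuousAt
      rw [Bundle.Trivialization.mem_source, show Z.proj (f i) = i from hf' i]
      exact Z.mem_baseSet_at i
    exact continuous_snd.continuousAt.comp (ContinuousAt.comp h1 f.continuous.continuousAt)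
  have hval : ∀ x : Ω, (Z.localTriv i (f x)).2 = ⟨(v x).val + (F x x - F i x)⟩ := by
    intro x
    rw [Z.localTriv_apply]
    show (⟨(v x).val + (F (f x).proj (f x).proj - F i (f x).proj)⟩ : DiscC) = _
    rw [hf']
  set c := (Z.localTriv i (f i)).2 with hc
  have hev : ∀ᶠ x : Ω in 𝓝 i, (Z.localTriv i (f x)).2 = c :=
    hcont.eventually_mem ((isOpen_discrete {c}).mem_nhds rfl)
  have hev' : ∀ᶠ y in 𝓝 w, ∀ h : y ∈ Ω, (Z.localTriv i (f ⟨y, h⟩)).2 = c := by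
    rw [nhds_subtype_eq_comap, Filter.eventually_comap] at hev
    filter_upwards [hev] with y hy h using hy ⟨y, h⟩ rfl
  have hder : HasDerivAt (fun y => c.val + F i y) (g w) w := by
    simpa using (hF i w (Metric.mem_ball_self (hr i))).const_add c.val
  refine hder.congr_of_eventuallyEq ?_
  filter_upwards [hev', hΩ.mem_nhds hw] with y hy hyΩ
  have h := hy hyΩ
  rw [hval] at h
  rw [dif_pos hyΩ, ← h]
  simp only
  ring

lemma lap_eq_laplacian {z : ℂ → ℝ} {w : ℂ} (hz : ContDiffAt ℝ 2 z w) :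
    lap z w = Laplacian.laplacian z w := by
  have hd : DifferentiableAt ℝ (fderiv ℝ z) w :=
    (hz.fderiv_right (m := 1) (by norm_num)).differentiableAt (by norm_num)
  rw [InnerProductSpace.laplacian_eq_iteratedFDeriv_complexPlane]
  simp only [lap, iteratedFDeriv_two_apply]
  rw [fderiv_clm_apply hd (by fun_prop), fderiv_clm_apply hd (by fun_prop)]
  simp

lemma hasFDerivAt_im_sq {u : ℂ → ℂ} {w : ℂ} (hu : DifferentiableAt ℝ u w) :
    HasFDerivAt (fun w => (u w).im ^ 2 / 2)
      ((u w).im • (Complex.imCLM.comp (fderiv ℝ u w))) w := by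
  have h : HasFDerivAt (fun w => (u w).im) (Complex.imCLM.comp (fderiv ℝ u w)) w :=
    Complex.imCLM.hasFDerivAt.comp w hu.hasFDerivAt
  have h2 := ((hasDerivAt_pow 2 ((u w).im)).div_const 2).comp_hasFDerivAt w h
  convert! h2 using 1
  simp


/-- Lemma 10.1 for the contactization of `(ℝ², −y dx)`: if
`Φ = (t, z, u) : Ω → ℝ × ℝ × ℝ²` is twice continuously differentiable and
`J′`-holomorphic on an open set `Ω ⊆ ℂ`, then `z` is harmonic on `Ω` and `u` is
holomorphic on `Ω`.  Conversely, if `Ω` is simply connected, `z` is harmonic and `u`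
is holomorphic, then there exists `t : Ω → ℝ` making `(t, z, u)` `J′`-holomorphic, and
any two such `t` differ by an additive constant. -/
theorem harmonic_lift_of_J_holomorphic (Ω : Set ℂ) (hΩ : IsOpen Ω) :
    (∀ (t z : ℂ → ℝ) (u : ℂ → ℂ),
      ContDiffOn ℝ 2 (fun w => (t w, z w, u w)) Ω →
      JHolomorphic t z u Ω →
      (∀ w ∈ Ω, lap z w = 0) ∧ DifferentiableOn ℂ u Ω) ∧
    (SimplyConnectedSpace Ω →
      ∀ (z : ℂ → ℝ) (u : ℂ → ℂ),
        ContDiffOn ℝ 2 z Ω → (∀ w ∈ Ω, lap z w = 0) →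
        DifferentiableOn ℂ u Ω →
        (∃ t : ℂ → ℝ, JHolomorphic t z u Ω) ∧
        ∀ t₁ t₂ : ℂ → ℝ, JHolomorphic t₁ z u Ω → JHolomorphic t₂ z u Ω →
          ∃ C : ℝ, ∀ w ∈ Ω, t₁ w = t₂ w + C) := by
  refine ⟨fun t z u hC hJ => ⟨fun w hw => ?_, fun w hw => ?_⟩, fun hsc z u hz hlap hu => ⟨?_, ?_⟩⟩
  · have ht2 : ContDiffOn ℝ 2 t Ω := hC.fst
    have hz2 : ContDiffOn ℝ 2 z Ω := hC.snd.fst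
    have hu2 : ContDiffOn ℝ 2 u Ω := hC.snd.snd
    have hN := hΩ.mem_nhds hw
    have htw : ContDiffAt ℝ 2 t w := ht2.contDiffAt hN
    have huw : ContDiffAt ℝ 2 u w := hu2.contDiffAt hN
    let s : ℂ → ℝ := fun w => t w - (u w).im ^ 2 / 2
    have hsw : ContDiffAt ℝ 2 s w := by
      have him : ContDiffAt ℝ 2 (fun w => (u w).im) w :=
        Complex.imCLM.contDiff.contDiffAt.comp w huw
      exact htw.sub ((him.pow 2).div_const 2)
    have hs : ∀ w ∈ Ω, ∀ ζ, fderiv ℝ s w ζ = fderiv ℝ z w (Complex.I * ζ) := by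
      intro w hw ζ
      obtain ⟨h1, h2, h3, h⟩ := hJ w hw
      have hd := h1.hasFDerivAt.sub (hasFDerivAt_im_sq h3)
      rw [(show HasFDerivAt s _ w from hd).fderiv, (h ζ).2.1]
      simp
    have hd : DifferentiableAt ℝ (fderiv ℝ s) w :=
      (hsw.fderiv_right (m := 1) (by norm_num)).differentiableAt (by norm_num)
    have e1 : (fun w' => fderiv ℝ z w' 1) =ᶠ[nhds w]
        fun w' => - fderiv ℝ s w' Complex.I := by
      filter_upwards [hN] with y hy
      rw [hs y hy]
      simp
    have e2 : (fun w' => fderiv ℝ z w' Complex.I) =ᶠ[nhds w]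
        fun w' => fderiv ℝ s w' 1 := by
      filter_upwards [hN] with y hy
      rw [hs y hy]
      simp
    rw [lap, e1.fderiv_eq, e2.fderiv_eq, fderiv_fun_neg, fderiv_clm_apply hd (by fun_prop),
      fderiv_clm_apply hd (by fun_prop)]
    have hsymm := hsw.isSymmSndFDerivAt (by simp) 1 Complex.I
    simp [hsymm]
  · obtain ⟨h1, h2, h3, h⟩ := hJ w hw
    refine DifferentiableAt.differentiableWithinAt ?_
    refine differentiableAt_complex_iff_differentiableAt_real.2 ⟨h3, ?_⟩
    have := (h 1).2.2
    rwa [mul_one] at this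
  · have hzw : ∀ w ∈ Ω, ContDiffAt ℝ 2 z w := fun w hw => hz.contDiffAt (hΩ.mem_nhds hw)
    have hg : DifferentiableOn ℂ
        (fun w => (fderiv ℝ z w 1 : ℂ) - Complex.I * fderiv ℝ z w Complex.I) Ω := by
      intro w hw
      refine DifferentiableAt.differentiableWithinAt
        (HarmonicAt.differentiableAt_complex_partial ⟨hzw w hw, ?_⟩)
      filter_upwards [hΩ.mem_nhds hw] with y hy
      rw [← lap_eq_laplacian (hzw y hy), hlap y hy]
      rfl
    obtain ⟨G, hG⟩ := exists_primitive_of_simplyConnected hΩ hsc hg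
    refine ⟨fun w => (u w).im ^ 2 / 2 - (G w).im, fun w hw => ?_⟩
    have huC : DifferentiableAt ℂ u w := (hu w hw).differentiableAt (hΩ.mem_nhds hw)
    have hud : DifferentiableAt ℝ u w := huC.restrictScalars ℝ
    have hGd : HasFDerivAt (fun w => (G w).im) _ w :=
      Complex.imCLM.hasFDerivAt.comp w ((hG w hw).hasFDerivAt.restrictScalars ℝ)
    have hd := (hasFDerivAt_im_sq hud).sub hGd
    have hd' : HasFDerivAt (fun w => (u w).im ^ 2 / 2 - (G w).im) _ w := hd
    have hul : ∀ ζ, fderiv ℝ u w (Complex.I * ζ) = Complex.I * fderiv ℝ u w ζ := by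
      intro ζ
      rw [huC.fderiv_restrictScalars ℝ]
      simpa using (fderiv ℂ u w).map_smul Complex.I ζ
    have hzl : ∀ ζ : ℂ, fderiv ℝ z w ζ
        = ζ.re * fderiv ℝ z w 1 + ζ.im * fderiv ℝ z w Complex.I := by
      intro ζ
      have : ζ = ζ.re • (1 : ℂ) + ζ.im • Complex.I := by
        simp
      conv_lhs => rw [this]
      rw [map_add, map_smul, map_smul]
      simp
    refine ⟨hd'.differentiableAt, (hzw w hw).differentiableAt (by norm_num), hud, fun ζ => ?_⟩
    rw [hd'.fderiv]
    refine ⟨?_, ?_, hul ζ⟩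
    · rw [hzl ζ]
      simp [hul]
      ring
    · rw [hzl (Complex.I * ζ)]
      simp
  · intro t₁ t₂ h₁ h₂
    have hc : IsPreconnected Ω := isPreconnected_iff_preconnectedSpace.2 inferInstance
    obtain ⟨C, hC⟩ := hΩ.exists_is_const_of_fderiv_eq_zero (𝕜 := ℝ)
      (f := fun w => t₁ w - t₂ w) hc
      (fun w hw => ((h₁ w hw).1.sub (h₂ w hw).1).differentiableWithinAt)
      (fun w hw => by
        rw [fderiv_fun_sub (h₁ w hw).1 (h₂ w hw).1]
        ext1 ζ
        have a := ((h₁ w hw).2.2.2 ζ).2.1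
        have b := ((h₂ w hw).2.2.2 ζ).2.1
        show fderiv ℝ t₁ w ζ - fderiv ℝ t₂ w ζ = 0
        linarith)
    exact ⟨C, fun w hw => by linarith [hC w hw]⟩

end
end

section
/- Fix ρ₀ > 0 and for t ∈ ℝ define Ψ_t : ℝ² × ℝ² → ℝ² × ℝ² by Ψ_t(x, y) = (x, y + (t/(2ρ₀²))·x). Fix θ ∈ (π/2, 3π/2) and set x_θ = (ρ₀ cos θ, ρ₀ sin θ) and y₀ = (1, 0). Write y(t) for the second (ℝ²) component of Ψ_t(x_θ, y₀), and set t* := −4ρ₀ cos θ. Then t* ≥ 0; |y(t)|² = 1 + (t/ρ₀)cos θ + t²/(4ρ₀²), so that |y(t)| ≤ 1 for 0 ≤ t ≤ t*, with equality exactly when t = 0 or t = t*; and y(t*) = (−cos 2θ, −sin 2θ) = (cos(2θ − π), sin(2θ − π)). -/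
noncomputable section

/-- The Reeb flow `Ψ_t(x, y) = (x, y + (t/(2ρ₀²))·x)` on `ℝ² × ℝ²`. -/
def Psi (ρ₀ t : ℝ) (xy : (ℝ × ℝ) × (ℝ × ℝ)) : (ℝ × ℝ) × (ℝ × ℝ) :=
  (xy.1, (xy.2.1 + t / (2 * ρ₀ ^ 2) * xy.1.1, xy.2.2 + t / (2 * ρ₀ ^ 2) * xy.1.2))

/-- The `y`-component of the trajectory starting at
`(x_θ, y₀) = ((ρ₀ cos θ, ρ₀ sin θ), (1, 0))`. -/
def ycurve (ρ₀ θ t : ℝ) : ℝ × ℝ :=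
  (Psi ρ₀ t ((ρ₀ * Real.cos θ, ρ₀ * Real.sin θ), (1, 0))).2

/-- Reeb trajectories across the square Weinstein handle: for `ρ₀ > 0`
and `θ ∈ (π/2, 3π/2)`, with `t* = −4ρ₀ cos θ`: `t* ≥ 0`;
`|y(t)|² = 1 + (t/ρ₀)cos θ + t²/(4ρ₀²)`, so `|y(t)| ≤ 1` for `0 ≤ t ≤ t*` with equality
exactly at `t = 0` and `t = t*`; and `y(t*) = (−cos 2θ, −sin 2θ) = (cos(2θ−π), sin(2θ−π))`. -/
theorem square_handle_trajectories (ρ₀ : ℝ) (hρ : 0 < ρ₀) (θ : ℝ)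
    (hθ₁ : Real.pi / 2 < θ) (hθ₂ : θ < 3 * Real.pi / 2) :
    0 ≤ -4 * ρ₀ * Real.cos θ ∧
    (∀ t : ℝ,
      (ycurve ρ₀ θ t).1 ^ 2 + (ycurve ρ₀ θ t).2 ^ 2
        = 1 + (t / ρ₀) * Real.cos θ + t ^ 2 / (4 * ρ₀ ^ 2)) ∧
    (∀ t : ℝ, 0 ≤ t → t ≤ -4 * ρ₀ * Real.cos θ →
      (ycurve ρ₀ θ t).1 ^ 2 + (ycurve ρ₀ θ t).2 ^ 2 ≤ 1 ∧
      ((ycurve ρ₀ θ t).1 ^ 2 + (ycurve ρ₀ θ t).2 ^ 2 = 1 ↔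
        t = 0 ∨ t = -4 * ρ₀ * Real.cos θ)) ∧
    ycurve ρ₀ θ (-4 * ρ₀ * Real.cos θ) = (-Real.cos (2 * θ), -Real.sin (2 * θ)) ∧
    -Real.cos (2 * θ) = Real.cos (2 * θ - Real.pi) ∧
    -Real.sin (2 * θ) = Real.sin (2 * θ - Real.pi) := by
  have hc : Real.cos θ < 0 :=
    Real.cos_neg_of_pi_div_two_lt_of_lt hθ₁ (by linarith)
  have hne : ρ₀ ≠ 0 := hρ.ne'
  have hsc := Real.sin_sq_add_cos_sq θ
  have key : ∀ t : ℝ, (ycurve ρ₀ θ t).1 ^ 2 + (ycurve ρ₀ θ t).2 ^ 2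
      = 1 + (t / ρ₀) * Real.cos θ + t ^ 2 / (4 * ρ₀ ^ 2) := by
    intro t
    have hs : Real.sin θ ^ 2 = 1 - Real.cos θ ^ 2 := by linarith
    simp only [ycurve, Psi]
    field_simp
    ring_nf
    rw [hs]
    ring
  have key2 : ∀ t : ℝ, (ycurve ρ₀ θ t).1 ^ 2 + (ycurve ρ₀ θ t).2 ^ 2
      = 1 + t * (t - -4 * ρ₀ * Real.cos θ) / (4 * ρ₀ ^ 2) := by
    intro t
    rw [key]
    field_simp
    ring
  refine ⟨by nlinarith, key, ?_, ?_, ?_, ?_⟩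
  · intro t h0 h1
    rw [key2]
    constructor
    · have : t * (t - -4 * ρ₀ * Real.cos θ) / (4 * ρ₀ ^ 2) ≤ 0 :=
        div_nonpos_of_nonpos_of_nonneg
          (mul_nonpos_of_nonneg_of_nonpos h0 (by linarith)) (by positivity)
      linarith
    · have h4 : (4 * ρ₀ ^ 2) ≠ 0 := by positivity
      rw [add_eq_left, div_eq_zero_iff, or_iff_left h4, mul_eq_zero, sub_eq_zero]
  · simp only [ycurve, Psi, Real.cos_two_mul, Real.sin_two_mul, Prod.mk.injEq]
    constructor <;> field_simp <;> ring
  · rw [Real.cos_sub_pi]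
  · rw [Real.sin_sub_pi]

end
end

section
/- On ℝ⁴ with coordinates (x₁, x₂, y₁, y₂) let λ₀ be the 1-form 2x₁dy₁ + y₁dx₁ + 2x₂dy₂ + y₂dx₂. Define Φ̄₋ : ℝ⁴ → ℝ⁴ by Φ̄₋(t, z, p, q) = (e^{2t}(z·cos 2πq − (p/2π)·sin 2πq), e^{2t}(z·sin 2πq + (p/2π)·cos 2πq), e^{−t}·cos 2πq, e^{−t}·sin 2πq). Then Φ̄₋*λ₀ = e^{t}(dz + p dq): for every point (t,z,p,q) and every tangent vector v = (v_t, v_z, v_p, v_q) ∈ ℝ⁴, the value of λ₀ at the point Φ̄₋(t,z,p,q) on the vector DΦ̄₋_{(t,z,p,q)}(v) equals e^{t}·(v_z + p·v_q). -/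
noncomputable section

/-- The embedding `Φ̄₋(t, z, p, q) = (e^{2t}(z cos 2πq − (p/2π) sin 2πq),
e^{2t}(z sin 2πq + (p/2π) cos 2πq), e^{−t} cos 2πq, e^{−t} sin 2πq)` of the
symplectization of the 1-jet space of `S¹` into `ℝ⁴` with coordinates
`(x₁, x₂, y₁, y₂)`. -/
def PhiBar (x : ℝ × ℝ × ℝ × ℝ) : ℝ × ℝ × ℝ × ℝ :=
  (Real.exp (2 * x.1) *
      (x.2.1 * Real.cos (2 * Real.pi * x.2.2.2)
        - x.2.2.1 / (2 * Real.pi) * Real.sin (2 * Real.pi * x.2.2.2)),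
   Real.exp (2 * x.1) *
      (x.2.1 * Real.sin (2 * Real.pi * x.2.2.2)
        + x.2.2.1 / (2 * Real.pi) * Real.cos (2 * Real.pi * x.2.2.2)),
   Real.exp (-x.1) * Real.cos (2 * Real.pi * x.2.2.2),
   Real.exp (-x.1) * Real.sin (2 * Real.pi * x.2.2.2))

/-- `Φ̄₋* λ₀ = e^t (dz + p dq)`, where
`λ₀ = 2x₁dy₁ + y₁dx₁ + 2x₂dy₂ + y₂dx₂` on `ℝ⁴`: for every point `pt = (t,z,p,q)` and
tangent vector `v = (v_t, v_z, v_p, v_q)`, evaluating `λ₀` at `Φ̄₋(pt)` on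
`DΦ̄₋_pt(v)` gives `e^t (v_z + p·v_q)`. -/
theorem jet_space_embedding_pullback (pt v : ℝ × ℝ × ℝ × ℝ) :
    2 * (PhiBar pt).1 * (fderiv ℝ PhiBar pt v).2.2.1
        + (PhiBar pt).2.2.1 * (fderiv ℝ PhiBar pt v).1
        + 2 * (PhiBar pt).2.1 * (fderiv ℝ PhiBar pt v).2.2.2
        + (PhiBar pt).2.2.2 * (fderiv ℝ PhiBar pt v).2.1
      = Real.exp pt.1 * (v.2.1 + pt.2.2.1 * v.2.2.2) := by
  obtain ⟨t, z, p, q⟩ := pt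
  obtain ⟨a, b, c, d⟩ := v
  have hd : DifferentiableAt ℝ PhiBar (t, z, p, q) := by
    unfold PhiBar
    fun_prop
  have hl : ∀ x m : ℝ, HasDerivAt (fun s : ℝ => x + s * m) m 0 := fun x m => by
    simpa using ((hasDerivAt_id (0 : ℝ)).mul_const m).const_add x
  have hline : HasDerivAt (fun s : ℝ => ((t + s * a, z + s * b, p + s * c, q + s * d) :
      ℝ × ℝ × ℝ × ℝ)) (a, b, c, d) 0 :=
    (hl t a).prodMk ((hl z b).prodMk ((hl p c).prodMk (hl q d)))
  have h1 := HasFDerivAt.comp_hasDerivAt_of_eq (0 : ℝ) hd.hasFDerivAt hline (by simp)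
  have he2 := ((hl t a).const_mul 2).exp
  have he := (hl t a).neg.exp
  have hc := ((hl q d).const_mul (2 * Real.pi)).cos
  have hs := ((hl q d).const_mul (2 * Real.pi)).sin
  have hp := (hl p c).div_const (2 * Real.pi)
  have h2 := (he2.mul (((hl z b).mul hc).sub (hp.mul hs))).prodMk
    ((he2.mul (((hl z b).mul hs).add (hp.mul hc))).prodMk
      ((he.mul hc).prodMk (he.mul hs)))
  have h3 := h1.unique h2
  rw [h3]
  have hsc := Real.sin_sq_add_cos_sq (2 * Real.pi * q)
  have hE : Real.exp (2 * t) = Real.exp t * Real.exp t := by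
    rw [← Real.exp_add]; ring_nf
  have hN : Real.exp t * Real.exp (-t) = 1 := by
    rw [← Real.exp_add]; simp
  have hpi := Real.pi_ne_zero
  simp only [PhiBar, Pi.neg_apply, Pi.mul_apply, Pi.sub_apply, Pi.add_apply, zero_mul, add_zero,
    hE]
  generalize Real.sin (2 * Real.pi * q) = S at *
  generalize Real.cos (2 * Real.pi * q) = C at *
  generalize Real.exp (-t) = N at *
  generalize Real.exp t = X at *
  field_simp
  linear_combination X ^ 2 * N * (2 * Real.pi * (b + p * d)) * hsc
    + X * (2 * Real.pi * (b + p * d)) * hN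

end
end
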